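/- For any SM(ASP) theory [F,Π]: (a) every path in the graph SM(ASP)L_{F,Π} contains only finitely many edges justified by basic transition rules; (b) for any semi-terminal state M‖Γ of SM(ASP)L_{F,Π} reachable from ∅‖∅, M is a model of [F,Π]; (c) Fail is reachable from ∅‖∅ in SM(ASP)L_{F,Π} if and only if [F,Π] has no models. -/

import Mathlib

set_option maxHeartbeats 1000000

attribute [local instance] Classical.propDecidable

/-! ## Atoms, literals, clauses -/

/-- Propositional atoms. -/
abbrev Atom : Type := ℕ

/-- Propositional literals: an atom or its negation. -/
inductive Lit where
  | pos : Atom → Lit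
  | neg : Atom → Lit
deriving DecidableEq

/-- The atom of a literal. -/
def Lit.atom : Lit → Atom
  | .pos a => a
  | .neg a => a

/-- The complement (dual) of a literal. -/
def Lit.compl : Lit → Lit
  | .pos a => .neg a
  | .neg a => .pos a

/-- A clause is a set of literals (read disjunctively). -/
abbrev Clause := Set Lit

/-- A CNF formula is a set of clauses. -/
abbrev CNF := Set Clause

/-- Truth of a literal in an interpretation given as the set of true atoms. -/
def litTrue (X : Set Atom) : Lit → Prop
  | .pos a => a ∈ X
  | .neg a => a ∉ X

/-- Truth of a CNF formula in an interpretation. -/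
def cnfTrue (X : Set Atom) (F : CNF) : Prop := ∀ C ∈ F, ∃ l ∈ C, litTrue X l

/-- A CNF formula is satisfiable if some interpretation makes it true. -/
def cnfSatisfiable (F : CNF) : Prop := ∃ X : Set Atom, cnfTrue X F

/-- A set `M` of literals is a model of a CNF formula if every clause contains a literal of `M`. -/
def modelCNF (M : Set Lit) (F : CNF) : Prop := ∀ C ∈ F, ∃ l ∈ C, l ∈ M

/-- A set of literals is consistent if it contains no atom together with its negation. -/
def consistentS (M : Set Lit) : Prop := ∀ a : Atom, ¬ (Lit.pos a ∈ M ∧ Lit.neg a ∈ M)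

/-- `M` is complete over a set `A` of atoms: every atom of `A` occurs (possibly negated)
in `M` and no other atoms occur in `M`. -/
def completeOver (M : Set Lit) (A : Set Atom) : Prop :=
  (∀ a ∈ A, Lit.pos a ∈ M ∨ Lit.neg a ∈ M) ∧ ∀ l ∈ M, l.atom ∈ A

/-- `M⁺`: the atoms occurring non-negated in `M`. -/
def posPart (M : Set Lit) : Set Atom := {a | Lit.pos a ∈ M}

/-- `M^A`: the literals of `M` whose atoms lie in `A`. -/
def restrictLits (M : Set Lit) (A : Set Atom) : Set Lit := {l ∈ M | l.atom ∈ A}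

/-- The set of complements of the literals of `M`. -/
def compls (M : Set Lit) : Set Lit := Lit.compl '' M

/-- The atoms occurring in a CNF formula. -/
def atomsCNF (F : CNF) : Set Atom := ⋃ C ∈ F, Lit.atom '' C

/-- A well-formed CNF formula: a finite set of finite non-empty clauses. -/
def IsCNF (F : CNF) : Prop := F.Finite ∧ ∀ C ∈ F, C.Finite ∧ C.Nonempty

/-! ## Logic programs -/

/-- A rule `a₀ ← a₁,…,a_l, not a_{l+1},…,not a_m, not not a_{m+1},…,not not a_n`.
`head = none` encodes the empty head `⊥` (a constraint). -/
structure Rule where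
  head : Option Atom
  bpos : Set Atom
  bneg : Set Atom
  bnneg : Set Atom

/-- The atoms occurring in the body of a rule. -/
def Rule.bodyAtoms (r : Rule) : Set Atom := r.bpos ∪ r.bneg ∪ r.bnneg

/-- The atoms occurring in a rule. -/
def Rule.atoms (r : Rule) : Set Atom :=
  (match r.head with | some a => ({a} : Set Atom) | none => (∅ : Set Atom)) ∪ r.bodyAtoms

/-- `s(B)` for the body of a rule: `{a₁,…,a_l, ¬a_{l+1},…,¬a_m, a_{m+1},…,a_n}`. -/
def Rule.sBody (r : Rule) : Set Lit :=
  Lit.pos '' r.bpos ∪ Lit.neg '' r.bneg ∪ Lit.pos '' r.bnneg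

/-- A (propositional) logic program, as a set of rules. -/
abbrev Program := Set Rule

/-- `Head(Π)`: the set of nonempty heads of rules of `Π`. -/
def headSet (P : Program) : Set Atom := {a | ∃ r ∈ P, r.head = some a}

/-- `At(Π)`: the set of atoms occurring in `Π`. -/
def atomsProg (P : Program) : Set Atom := ⋃ r ∈ P, r.atoms

/-- A well-formed logic program: finitely many rules, finite bodies, and
constraints have non-empty bodies. -/
def IsProgram (P : Program) : Prop :=
  P.Finite ∧ (∀ r ∈ P, r.bpos.Finite ∧ r.bneg.Finite ∧ r.bnneg.Finite) ∧
    ∀ r ∈ P, r.head = none → r.bodyAtoms.Nonempty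

/-- Rule bodies, as triples (positive part, negated part, doubly negated part). -/
abbrev BodyT := Set Atom × Set Atom × Set Atom

/-- The body of a rule. -/
def Rule.body (r : Rule) : BodyT := (r.bpos, r.bneg, r.bnneg)

/-- `s(B)` for a body triple. -/
def sBodyB (B : BodyT) : Set Lit := Lit.pos '' B.1 ∪ Lit.neg '' B.2.1 ∪ Lit.pos '' B.2.2

/-- `Bodies(Π,a)`: the set of bodies of rules of `Π` with head `a`. -/
def bodiesOf (P : Program) (a : Atom) : Set BodyT := {B | ∃ r ∈ P, r.head = some a ∧ r.body = B}

/-! ## Answer sets -/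

/-- A rule survives the reduct with respect to `X`: no `not a` with `a ∈ X`
and no `not not a` with `a ∉ X` occurs in its body. -/
def reductKeeps (r : Rule) (X : Set Atom) : Prop :=
  (∀ a ∈ r.bneg, a ∉ X) ∧ ∀ a ∈ r.bnneg, a ∈ X

/-- `Y` is closed under the positive (non-constraint) rules of the reduct of `P` w.r.t. `X`. -/
def closedUnder (P : Program) (X Y : Set Atom) : Prop :=
  ∀ r ∈ P, reductKeeps r X → r.bpos ⊆ Y → ∀ a, r.head = some a → a ∈ Y

/-- `X` is an answer set of `P`: `X` is the least model of the positive part of the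
reduct `P^X`, and no constraint of the reduct has its body contained in `X`. -/
def isAnswerSet (P : Program) (X : Set Atom) : Prop :=
  X = ⋂₀ {Y | closedUnder P X Y} ∧
    ∀ r ∈ P, r.head = none → reductKeeps r X → ¬ r.bpos ⊆ X

/-- The fact `a ←`. -/
def factRule (a : Atom) : Rule := ⟨some a, ∅, ∅, ∅⟩

/-- The choice rule `a ← not not a`. -/
def choiceRule (a : Atom) : Rule := ⟨some a, ∅, ∅, {a}⟩

/-- `X` is an input answer set of `P`: `X` is an answer set of `P ∪ (X \ Head(P))`. -/
def inputAnswerSet (P : Program) (X : Set Atom) : Prop :=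
  isAnswerSet (P ∪ factRule '' (X \ headSet P)) X

/-- `Π_A`: `Π` extended with the rule `a ← not not a` for each `a ∈ A \ Head(Π)`. -/
def progExt (P : Program) (A : Set Atom) : Program := P ∪ choiceRule '' (A \ headSet P)

/-- `At(F ∪ Π)`: the atoms occurring in `F` and `Π`. -/
def atomsTh (F : CNF) (P : Program) : Set Atom := atomsCNF F ∪ atomsProg P

/-- `Π^o = Π_{At(F∪Π)}` for the pair `[F,Π]`. -/
def progO (F : CNF) (P : Program) : Program := progExt P (atomsTh F P)

/-- A model of the SM(ASP) theory `[F,Π]`: a consistent set of literals complete over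
`At(F∪Π)` that is a model of `F` and whose positive part is an input answer set of `Π`. -/
def smModel (F : CNF) (P : Program) (M : Set Lit) : Prop :=
  consistentS M ∧ completeOver M (atomsTh F P) ∧ modelCNF M F ∧ inputAnswerSet P (posPart M)

/-! ## Unfounded sets and the well-founded operator -/

/-- `U` is unfounded on `M` with respect to `P`. -/
def unfoundedOn (U : Set Atom) (M : Set Lit) (P : Program) : Prop :=
  U ⊆ atomsProg P ∧
    ∀ a ∈ U, ∀ r ∈ P, r.head = some a →
      (∃ l ∈ r.sBody, l.compl ∈ M) ∨ ∃ b ∈ r.bpos, b ∈ U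

/-- The greatest unfounded set on `M` with respect to `P`. -/
def GUS (M : Set Lit) (P : Program) : Set Atom := ⋃₀ {U | unfoundedOn U M P}

/-- The operator `W_P` of the well-founded semantics. -/
noncomputable def WOp (P : Program) (M : Set Lit) : Set Lit :=
  if consistentS M then
    M ∪ Lit.pos '' {a | ∃ r ∈ P, r.head = some a ∧ r.sBody ⊆ M} ∪ Lit.neg '' GUS M P
  else Lit.pos '' atomsProg P ∪ Lit.neg '' atomsProg P

/-- `W^i_P(M)`: the `i`-fold application of `W_P` to `M`. -/
noncomputable def WIter (P : Program) : ℕ → Set Lit → Set Lit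
  | 0, M => M
  | n + 1, M => WOp P (WIter P n M)

/-- `W^fix_P(M)`: the least fixpoint of `W_P` above `M`. -/
def WFix (P : Program) (M : Set Lit) : Set Lit := ⋂₀ {Y | M ⊆ Y ∧ WOp P Y ⊆ Y}

/-! ## PC(ID) -/

/-- A program is weakly normal if every head is an atom. -/
def weaklyNormal (P : Program) : Prop := ∀ r ∈ P, r.head ≠ none

/-- A program is normal if every head is an atom and no double negation occurs. -/
def normalProg (P : Program) : Prop := ∀ r ∈ P, r.head ≠ none ∧ r.bnneg = ∅

/-- `O^Π = At(F∪Π) \ Head(Π)`: the open atoms of the pair `(F,Π)`. -/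
def openAtomsTh (F : CNF) (P : Program) : Set Atom := atomsTh F P \ headSet P

/-- A model of the PC(ID) theory `(F,Π)`. -/
def pcidModel (F : CNF) (P : Program) (M : Set Lit) : Prop :=
  consistentS M ∧ completeOver M (atomsTh F P) ∧ modelCNF M F ∧
    M = WFix (progO F P) (restrictLits M (openAtomsTh F P))

/-- The PC(ID) theory `(F,Π)` is total: `W^fix_{Π^o}(M^{O^Π})` assigns all atoms of
`At(F∪Π)` for every model `M` of `F`. -/
def pcidTotal (F : CNF) (P : Program) : Prop :=
  ∀ M : Set Lit, consistentS M → completeOver M (atomsTh F P) → modelCNF M F →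
    ∀ a ∈ atomsTh F P,
      Lit.pos a ∈ WFix (progO F P) (restrictLits M (openAtomsTh F P)) ∨
      Lit.neg a ∈ WFix (progO F P) (restrictLits M (openAtomsTh F P))

/-! ## Clausal forms and completion -/

/-- The clause corresponding to a rule. -/
def ruleClause (r : Rule) : Clause :=
  (match r.head with | some a => ({Lit.pos a} : Set Lit) | none => (∅ : Set Lit)) ∪
    (Lit.neg '' r.bpos ∪ Lit.pos '' r.bneg ∪ Lit.neg '' r.bnneg)

/-- `Π^cl`: the clause forms of the rules of `Π`. -/
def progCl (P : Program) : CNF := ruleClause '' P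

/-- `a` is a fact in `P`: some rule with head `a` has an empty body. -/
def isFactAtom (P : Program) (a : Atom) : Prop :=
  ∃ r ∈ P, r.head = some a ∧ r.bodyAtoms = ∅

/-- `Comp(Π)`: the clausified completion of `Π`: the clauses `Π^cl` together with all
clauses obtained by distributivity from `¬a ∨ ⋁_{B ∈ Bodies(Π,a)} B`, for every
atom `a` of `Π` that is not a fact. -/
def compClauses (P : Program) : CNF :=
  progCl P ∪
    {C | ∃ a ∈ atomsProg P, ¬ isFactAtom P a ∧
      ∃ f : BodyT → Lit, (∀ B ∈ bodiesOf P a, f B ∈ sBodyB B) ∧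
        C = insert (Lit.neg a) (f '' bodiesOf P a)}

/-- The number of program literals in a body. -/
noncomputable def bodySize (B : BodyT) : ℕ := B.1.ncard + B.2.1.ncard + B.2.2.ncard

/-- `ν` provides the literals `f_B` used by `ED-Comp`: for a singleton body, the
literal `s(l)` of its unique element; for larger bodies, fresh pairwise distinct atoms. -/
def goodNaming (P : Program) (ν : BodyT → Lit) : Prop :=
  (∀ B : BodyT, bodySize B = 1 → ν B ∈ sBodyB B) ∧
  (∀ B : BodyT, 1 < bodySize B → (∃ a : Atom, ν B = Lit.pos a) ∧ (ν B).atom ∉ atomsProg P) ∧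
  ∀ B B' : BodyT, 1 < bodySize B → 1 < bodySize B' → ν B = ν B' → B = B'

/-- `ED-Comp(P)` with respect to the naming `ν`. -/
def EDComp (ν : BodyT → Lit) (P : Program) : CNF :=
  progCl P ∪
  {C | ∃ a ∈ atomsProg P, ¬ isFactAtom P a ∧ ¬ (bodiesOf P a).Subsingleton ∧
        C = insert (Lit.neg a) (ν '' bodiesOf P a)} ∪
  {C | ∃ a ∈ atomsProg P, ∃ B : BodyT, bodiesOf P a = {B} ∧ ∃ l ∈ sBodyB B, C = {Lit.neg a, l}} ∪
  {C | ∃ a ∈ atomsProg P, bodiesOf P a = ∅ ∧ C = {Lit.neg a}} ∪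
  {C | ∃ a ∈ atomsProg P, ¬ isFactAtom P a ∧ ¬ (bodiesOf P a).Subsingleton ∧
        ∃ B ∈ bodiesOf P a, 1 < bodySize B ∧
          ((∃ l ∈ sBodyB B, C = {(ν B).compl, l}) ∨ C = insert (ν B) (compls (sBodyB B)))}

/-! ## PC(ID) theories as programs with constraints -/

/-- `C^r`: the constraint corresponding to a clause `C`. -/
def clauseRule (C : Clause) : Rule := ⟨none, {a | Lit.neg a ∈ C}, {a | Lit.pos a ∈ C}, ∅⟩

/-- `F^r = {C^r : C ∈ F}`. -/
def constraintsOf (F : CNF) : Program := clauseRule '' F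

/-- `π(F,Π) = Π^o ∪ F^r`. -/
def piProg (F : CNF) (P : Program) : Program := progO F P ∪ constraintsOf F

/-! ## Program transformations `ch(N)` and `Π(N)` -/

/-- `ch(N)`: the rules `a ← not not a` for the atoms `a` occurring in `N`. -/
def chProg (N : Set Lit) : Program := choiceRule '' (Lit.atom '' N)

/-- The body of `r` contains a program literal `l` with `s(l)` complement in `N`. -/
def ruleKilled (r : Rule) (N : Set Lit) : Prop :=
  (∃ a ∈ r.bpos, Lit.neg a ∈ N) ∨ (∃ a ∈ r.bneg, Lit.pos a ∈ N) ∨ ∃ a ∈ r.bnneg, Lit.neg a ∈ N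

/-- Delete from the body of `r` every program literal `l` with `s(l) ∈ N`. -/
def ruleReduce (r : Rule) (N : Set Lit) : Rule :=
  ⟨r.head, {a ∈ r.bpos | Lit.pos a ∉ N}, {a ∈ r.bneg | Lit.neg a ∉ N},
    {a ∈ r.bnneg | Lit.pos a ∉ N}⟩

/-- `Π(N)`: remove the rules killed by `N` and reduce the bodies of the remaining rules. -/
def progReduce (P : Program) (N : Set Lit) : Program :=
  (fun r => ruleReduce r N) '' {r ∈ P | ¬ ruleKilled r N}

/-! ## DPLL states and transition graphs -/

/-- A possibly decision-annotated literal. -/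
structure ALit where
  lit : Lit
  dec : Bool
deriving DecidableEq

/-- A state: `fail` or a record (ordered list of annotated literals). -/
inductive DpState where
  | fail : DpState
  | of : List ALit → DpState

/-- The literals of a record, in order. -/
def litsOf (M : List ALit) : List Lit := M.map ALit.lit

/-- The set of literals of a record. -/
def litSet (M : List ALit) : Set Lit := {l | l ∈ litsOf M}

/-- A record is inconsistent if it contains an atom together with its negation. -/
def inconsistentRec (M : List ALit) : Prop :=
  ∃ a : Atom, Lit.pos a ∈ litsOf M ∧ Lit.neg a ∈ litsOf M

/-- A record contains no decision literals. -/
def noDecision (M : List ALit) : Prop := ∀ x ∈ M, x.dec = false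

/-- `l` is unassigned by the record `M`. -/
def unassignedBy (M : List ALit) (l : Lit) : Prop := l ∉ litsOf M ∧ l.compl ∉ litsOf M

/-- A record relative to the set `A` of atoms: an ordered set of literals over `A`. -/
def isRecord (A : Set Atom) (M : List ALit) : Prop :=
  (litsOf M).Nodup ∧ ∀ l ∈ litsOf M, l.atom ∈ A

/-- A state relative to the set `A` of atoms. -/
def isState (A : Set Atom) : DpState → Prop
  | .fail => True
  | .of M => isRecord A M

/-- The transition rules of the DPLL graph of the clause set `G`. -/
inductive DPStep (G : CNF) : DpState → DpState → Prop
  | unitPropagate (M : List ALit) (C : Clause) (l : Lit) :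
      C ∈ G → l ∈ C → (∀ k ∈ C, k ≠ l → k.compl ∈ litsOf M) →
      DPStep G (.of M) (.of (M ++ [⟨l, false⟩]))
  | decide (M : List ALit) (l : Lit) :
      unassignedBy M l → DPStep G (.of M) (.of (M ++ [⟨l, true⟩]))
  | fail (M : List ALit) :
      inconsistentRec M → noDecision M → DPStep G (.of M) .fail
  | backtrack (Pre Q : List ALit) (l : Lit) :
      inconsistentRec (Pre ++ ⟨l, true⟩ :: Q) → noDecision Q →
      DPStep G (.of (Pre ++ ⟨l, true⟩ :: Q)) (.of (Pre ++ [⟨l.compl, false⟩]))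

/-- The edges of the graph `DP_G` over states relative to `A`. -/
def dpEdge (G : CNF) (A : Set Atom) (s s' : DpState) : Prop :=
  isState A s ∧ isState A s' ∧ DPStep G s s'

/-- The transition rules of the graph `SM(ASP)_{F,Π}`: the DPLL rules for `F ∪ Π^cl`
together with the rule Unfounded (w.r.t. `Π^o`). -/
inductive SMStep (F : CNF) (P : Program) : DpState → DpState → Prop
  | dpll {s s' : DpState} : DPStep (F ∪ progCl P) s s' → SMStep F P s s'
  | unfounded (M : List ALit) (U : Set Atom) (a : Atom) :
      consistentS (litSet M) → unfoundedOn U (litSet M) (progO F P) → a ∈ U →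
      SMStep F P (.of M) (.of (M ++ [⟨Lit.neg a, false⟩]))

/-- The edges of the graph `SM(ASP)_{F,Π}`. -/
def smEdge (F : CNF) (P : Program) (s s' : DpState) : Prop :=
  isState (atomsTh F P) s ∧ isState (atomsTh F P) s' ∧ SMStep F P s s'

/-- `F,Π^o ⊨ C`: every model of the SM(ASP) theory `[F,Π]` satisfies the clause `C`. -/
def entailsClause (F : CNF) (P : Program) (C : Clause) : Prop :=
  ∀ M : Set Lit, smModel F P M → ∃ l ∈ C, l ∈ M

/-- Augmented states: `fail`, or a record together with a set of learned clauses. -/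
inductive ANode where
  | fail : ANode
  | st : List ALit → CNF → ANode

/-- A valid augmented state relative to `F` and `Π`. -/
def isANode (F : CNF) (P : Program) : ANode → Prop
  | .fail => True
  | .st M Γ => isRecord (atomsTh F P) M ∧
      ∀ C ∈ Γ, (∀ l ∈ C, l.atom ∈ atomsTh F P) ∧ entailsClause F P C

/-- The basic transition rules of the graph `SM(ASP)L_{F,Π}`. -/
inductive SMLBasic (F : CNF) (P : Program) : ANode → ANode → Prop
  | unitPropagateLearn (M : List ALit) (Γ : CNF) (C : Clause) (l : Lit) :
      C ∈ F ∪ progCl P ∪ Γ → l ∈ C → (∀ k ∈ C, k ≠ l → k.compl ∈ litsOf M) →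
      SMLBasic F P (.st M Γ) (.st (M ++ [⟨l, false⟩]) Γ)
  | decide (M : List ALit) (Γ : CNF) (l : Lit) :
      unassignedBy M l → SMLBasic F P (.st M Γ) (.st (M ++ [⟨l, true⟩]) Γ)
  | fail (M : List ALit) (Γ : CNF) :
      inconsistentRec M → noDecision M → SMLBasic F P (.st M Γ) .fail
  | backjump (Pre Q : List ALit) (l l' : Lit) (Γ : CNF) :
      inconsistentRec (Pre ++ ⟨l, true⟩ :: Q) →
      entailsClause F P (insert l' (compls (litSet Pre))) →
      SMLBasic F P (.st (Pre ++ ⟨l, true⟩ :: Q) Γ) (.st (Pre ++ [⟨l', false⟩]) Γ)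
  | unfounded (M : List ALit) (Γ : CNF) (U : Set Atom) (a : Atom) :
      consistentS (litSet M) → unfoundedOn U (litSet M) (progO F P) → a ∈ U →
      SMLBasic F P (.st M Γ) (.st (M ++ [⟨Lit.neg a, false⟩]) Γ)

/-- The transition rule Learn of `SM(ASP)L_{F,Π}`. -/
def learnStep (F : CNF) (P : Program) (n n' : ANode) : Prop :=
  ∃ (M : List ALit) (Γ : CNF) (C : Clause),
    n = ANode.st M Γ ∧ n' = ANode.st M (insert C Γ) ∧
    (∀ l ∈ C, l.atom ∈ atomsCNF F) ∧ entailsClause F P C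

/-- The transition rules of `SM(ASP)L_{F,Π}`: the basic rules and Learn. -/
def SMLStep (F : CNF) (P : Program) (n n' : ANode) : Prop :=
  SMLBasic F P n n' ∨ learnStep F P n n'

/-- The edges of the graph `SM(ASP)L_{F,Π}`. -/
def smlEdge (F : CNF) (P : Program) (n n' : ANode) : Prop :=
  isANode F P n ∧ isANode F P n' ∧ SMLStep F P n n'

/-- The edges of `SM(ASP)L_{F,Π}` justified by a basic transition rule. -/
def smlBasicEdge (F : CNF) (P : Program) (n n' : ANode) : Prop :=
  isANode F P n ∧ isANode F P n' ∧ SMLBasic F P n n'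

/-- `F` is a `Π`-safe set of clauses. -/
def piSafe (F : CNF) (P : Program) : Prop :=
  (∀ a ∈ atomsProg P \ headSet P, ∀ X : Set Atom, cnfTrue X F → a ∉ X) ∧
  ∀ X : Set Atom, isAnswerSet P X →
    ∃ M : Set Lit, consistentS M ∧ completeOver M (atomsTh F P) ∧ modelCNF M F ∧
      X = posPart M ∩ headSet P

/-! ## Literals and records -/

@[simp] theorem Lit.compl_compl (l : Lit) : l.compl.compl = l := by cases l <;> rfl

@[simp] theorem Lit.atom_compl (l : Lit) : l.compl.atom = l.atom := by cases l <;> rfl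

theorem not_compl_mem_of_consistentS {M : Set Lit} (hM : consistentS M) {l : Lit} (hl : l ∈ M) :
    l.compl ∉ M := by
  intro h
  cases l with
  | pos a => exact hM a ⟨hl, h⟩
  | neg a => exact hM a ⟨h, hl⟩

theorem mem_or_compl_mem_of_completeOver {M : Set Lit} {A : Set Atom} (hM : completeOver M A)
    {l : Lit} (hl : l.atom ∈ A) : l ∈ M ∨ l.compl ∈ M := by
  cases l with
  | pos a => exact hM.1 a hl
  | neg a => exact (hM.1 a hl).symm

theorem consistentS_litSet_iff (M : List ALit) : consistentS (litSet M) ↔ ¬ inconsistentRec M := by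
  simp [consistentS, inconsistentRec, litSet]

theorem mem_litSet_append {l : Lit} {M N : List ALit} :
    l ∈ litSet (M ++ N) ↔ l ∈ litSet M ∨ l ∈ litSet N := by
  simp [litSet, litsOf]

theorem mem_litSet_singleton {l : Lit} {x : ALit} : l ∈ litSet [x] ↔ l = x.lit := by
  simp [litSet, litsOf]

theorem litSet_append_singleton_subset {M : List ALit} {x : ALit} {N : Set Lit} :
    litSet (M ++ [x]) ⊆ N ↔ litSet M ⊆ N ∧ x.lit ∈ N := by
  constructor
  · intro h
    exact ⟨fun l hl => h (mem_litSet_append.2 (Or.inl hl)),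
      h (mem_litSet_append.2 (Or.inr (mem_litSet_singleton.2 rfl)))⟩
  · rintro ⟨h1, h2⟩ l hl
    rcases mem_litSet_append.1 hl with h | h
    · exact h1 h
    · rw [mem_litSet_singleton.1 h]; exact h2

theorem isRecord_append_singleton {A : Set Atom} {M : List ALit} {x : ALit}
    (hM : isRecord A M) (hx : x.lit ∉ litsOf M) (hA : x.lit.atom ∈ A) :
    isRecord A (M ++ [x]) := by
  refine ⟨?_, ?_⟩
  · simp only [litsOf, List.map_append, List.map_cons, List.map_nil] at *
    rw [List.nodup_append]
    refine ⟨hM.1, by simp, ?_⟩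
    intro a ha b hb
    rw [List.mem_singleton] at hb
    rintro rfl
    exact hx (hb ▸ ha)
  · intro l hl
    simp only [litsOf, List.map_append, List.map_cons, List.map_nil, List.mem_append,
      List.mem_singleton] at hl
    rcases hl with h | rfl
    · exact hM.2 l h
    · exact hA

theorem isRecord.of_append {A : Set Atom} {M N : List ALit} (h : isRecord A (M ++ N)) :
    isRecord A M := by
  refine ⟨?_, fun l hl => h.2 l (mem_litSet_append.2 (Or.inl hl))⟩
  have := h.1
  simp only [litsOf, List.map_append] at this
  exact this.of_append_left

theorem noDecision_or_last_decision (M : List ALit) :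
    noDecision M ∨ ∃ Pre l Q, M = Pre ++ ⟨l, true⟩ :: Q ∧ noDecision Q := by
  induction M with
  | nil => left; simp [noDecision]
  | cons x M ih =>
    rcases ih with h | ⟨Pre, l, Q, rfl, hQ⟩
    · obtain ⟨l, d⟩ := x
      cases d
      · left
        simpa [noDecision] using h
      · exact Or.inr ⟨[], l, M, rfl, h⟩
    · exact Or.inr ⟨x :: Pre, l, Q, rfl, hQ⟩

/-! ## Finiteness of the set of atoms -/

theorem atomsTh_finite {F : CNF} {P : Program} (hF : IsCNF F) (hP : IsProgram P) :
    (atomsTh F P).Finite := by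
  refine Set.Finite.union ?_ ?_
  · exact hF.1.biUnion fun C hC => (hF.2 C hC).1.image _
  · refine hP.1.biUnion fun r hr => ?_
    obtain ⟨h1, h2, h3⟩ := hP.2.1 r hr
    refine Set.Finite.union ?_ ((h1.union h2).union h3)
    cases r.head <;> simp

theorem isRecord.length_le {A : Set Atom} (hA : A.Finite) {M : List ALit} (hM : isRecord A M) :
    M.length ≤ (Lit.pos '' A ∪ Lit.neg '' A).ncard := by
  have hfin : (Lit.pos '' A ∪ Lit.neg '' A).Finite := (hA.image _).union (hA.image _)
  have h1 : M.length = (litsOf M).toFinset.card := by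
    rw [List.toFinset_card_of_nodup hM.1, litsOf, List.length_map]
  rw [h1, ← Set.ncard_coe_finset]
  refine Set.ncard_le_ncard ?_ hfin
  intro l hl
  have := hM.2 l (by simpa using hl)
  cases l with
  | pos a => exact Or.inl ⟨a, this, rfl⟩
  | neg a => exact Or.inr ⟨a, this, rfl⟩

/-! ## A bounded measure that increases along basic edges -/

/-- Records read as base-3 numbers with `n` digits, most significant first: a decision literal is
the digit 1, any other literal the digit 2. -/
def recordWeight : ℕ → List ALit → ℕ
  | 0, _ => 0
  | _ + 1, [] => 0
  | n + 1, x :: M => (if x.dec then 1 else 2) * 3 ^ n + recordWeight n M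

theorem recordWeight_lt (n : ℕ) (M : List ALit) : recordWeight n M < 3 ^ n := by
  induction n generalizing M with
  | zero => simp [recordWeight]
  | succ n ih =>
    cases M with
    | nil => simp [recordWeight]
    | cons x M =>
      have := ih M
      rw [recordWeight, pow_succ]
      split <;> omega

theorem recordWeight_append_lt {L L' : List ALit}
    (h : ∀ n, 0 < n → recordWeight n L < recordWeight n L') (Pre : List ALit) {n : ℕ}
    (hn : Pre.length < n) : recordWeight n (Pre ++ L) < recordWeight n (Pre ++ L') := by
  induction Pre generalizing n with
  | nil => exact h n hn
  | cons x Pre ih =>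
    cases n with
    | zero => simp at hn
    | succ n =>
      simp only [List.cons_append, recordWeight]
      have := ih (n := n) (by simpa using hn)
      omega

theorem recordWeight_lt_append_singleton (M : List ALit) (x : ALit) {n : ℕ} (hn : M.length < n) :
    recordWeight n M < recordWeight n (M ++ [x]) := by
  have := recordWeight_append_lt (L := []) (L' := [x]) ?_ M hn
  · simpa using this
  · intro k hk
    cases k with
    | zero => omega
    | succ k =>
      have : 0 < 3 ^ k := by positivity
      simp only [recordWeight]
      split <;> omega

/-- `recordWeight` extended to augmented states, with `fail` above all records. -/
def nodeWeight (n : ℕ) : ANode → ℕ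
  | .fail => 3 ^ n
  | .st M _ => recordWeight n M

theorem nodeWeight_le (n : ℕ) (s : ANode) : nodeWeight n s ≤ 3 ^ n := by
  cases s with
  | fail => exact le_rfl
  | st M Γ => exact (recordWeight_lt n M).le

theorem nodeWeight_lt_of_smlBasicEdge {F : CNF} {P : Program} {n : ℕ}
    (hn : ∀ M, isRecord (atomsTh F P) M → M.length ≤ n) {s s' : ANode}
    (h : smlBasicEdge F P s s') : nodeWeight n s < nodeWeight n s' := by
  obtain ⟨-, hs', h⟩ := h
  cases h with
  | unitPropagateLearn M Γ C l hC hl hk =>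
    have := hn _ hs'.1
    exact recordWeight_lt_append_singleton _ _ (by simpa using this)
  | decide M Γ l hl =>
    have := hn _ hs'.1
    exact recordWeight_lt_append_singleton _ _ (by simpa using this)
  | fail M Γ h1 h2 => exact recordWeight_lt _ _
  | backjump Pre Q l l' Γ h1 h2 =>
    have := hn _ hs'.1
    refine recordWeight_append_lt ?_ Pre (by simpa using this)
    intro k hk
    cases k with
    | zero => omega
    | succ k =>
      have := recordWeight_lt k Q
      simp only [recordWeight]
      simp
      omega
  | unfounded M Γ U a h1 h2 h3 =>
    have := hn _ hs'.1
    exact recordWeight_lt_append_singleton _ _ (by simpa using this)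

theorem nodeWeight_eq_of_learnStep {F : CNF} {P : Program} (n : ℕ) {s s' : ANode}
    (h : learnStep F P s s') : nodeWeight n s = nodeWeight n s' := by
  obtain ⟨M, Γ, C, rfl, rfl, -⟩ := h
  rfl

theorem finite_setOf_lt_succ_of_monotone_of_le {f : ℕ → ℕ} (hf : Monotone f) {b : ℕ}
    (hb : ∀ n, f n ≤ b) : {n | f n < f (n + 1)}.Finite := by
  refine Set.Finite.of_finite_image (f := f) ((Set.finite_Iic b).subset ?_) ?_
  · rintro _ ⟨n, -, rfl⟩
    exact hb n
  · intro m hm n hn hmn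
    simp only [Set.mem_ofPred_eq] at hm hn
    by_contra hne
    rcases lt_or_gt_of_ne hne with h | h
    · have := hf (Nat.succ_le_of_lt h)
      simp only [Nat.succ_eq_add_one] at this
      omega
    · have := hf (Nat.succ_le_of_lt h)
      simp only [Nat.succ_eq_add_one] at this
      omega

/-! ## Models -/

theorem smModel.mem_or_compl_mem {F : CNF} {P : Program} {N : Set Lit} (hN : smModel F P N)
    {l : Lit} (hl : l.atom ∈ atomsTh F P) : l ∈ N ∨ l.compl ∈ N :=
  mem_or_compl_mem_of_completeOver hN.2.1 hl

theorem smModel.neg_mem_iff {F : CNF} {P : Program} {N : Set Lit} (hN : smModel F P N)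
    {a : Atom} (ha : a ∈ atomsTh F P) : Lit.neg a ∈ N ↔ a ∉ posPart N := by
  constructor
  · exact fun h h' => hN.1 a ⟨h', h⟩
  · intro h
    exact (hN.2.1.1 a ha).resolve_left h

theorem closedUnder_sInter (P : Program) (X : Set Atom) :
    closedUnder P X (⋂₀ {Y | closedUnder P X Y}) := by
  intro r hr hk hb a ha Y hY
  exact hY r hr hk (fun b hbb => hb hbb Y hY) a ha

theorem isAnswerSet.closedUnder_self {P : Program} {X : Set Atom} (h : isAnswerSet P X) :
    closedUnder P X X := by
  have := closedUnder_sInter P X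
  rwa [← h.1] at this

theorem atoms_subset_atomsTh {F : CNF} {P : Program} {r : Rule} (hr : r ∈ P) :
    r.atoms ⊆ atomsTh F P :=
  fun _ ha => Or.inr (Set.mem_biUnion hr ha)

theorem atom_mem_of_mem_ruleClause {r : Rule} {l : Lit} (hl : l ∈ ruleClause r) :
    l.atom ∈ r.atoms := by
  rcases hl with h | (⟨b, hb, rfl⟩ | ⟨b, hb, rfl⟩) | ⟨b, hb, rfl⟩
  · left
    cases hr : r.head with
    | none => simp [hr] at h
    | some a =>
      simp only [hr, Set.mem_singleton_iff] at h
      simp [h, Lit.atom]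
  · exact Or.inr (Or.inl (Or.inl hb))
  · exact Or.inr (Or.inl (Or.inr hb))
  · exact Or.inr (Or.inr hb)

theorem pos_mem_ruleClause {r : Rule} {a : Atom} (h : r.head = some a) :
    Lit.pos a ∈ ruleClause r := by
  left
  simp [h]

theorem head_mem_atoms {r : Rule} {a : Atom} (h : r.head = some a) : a ∈ r.atoms := by
  left
  simp [h]

theorem atom_mem_atomsTh_of_mem {F : CNF} {P : Program} {C : Clause} (hC : C ∈ F ∪ progCl P)
    {l : Lit} (hl : l ∈ C) : l.atom ∈ atomsTh F P := by
  rcases hC with hC | ⟨r, hr, rfl⟩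
  · exact Or.inl (Set.mem_biUnion hC ⟨l, hl, rfl⟩)
  · exact atoms_subset_atomsTh hr (atom_mem_of_mem_ruleClause hl)

theorem atomsProg_progO (F : CNF) (P : Program) : atomsProg (progO F P) = atomsTh F P := by
  ext a
  simp only [atomsProg, Set.mem_iUnion]
  constructor
  · rintro ⟨r, hr | ⟨b, hb, rfl⟩, ha⟩
    · exact atoms_subset_atomsTh hr ha
    · have : a = b := by
        simpa [Rule.atoms, choiceRule, Rule.bodyAtoms] using ha
      exact this ▸ hb.1
  · intro ha
    by_cases h : a ∈ headSet P
    · obtain ⟨r, hr, hh⟩ := h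
      exact ⟨r, Or.inl hr, head_mem_atoms hh⟩
    · exact ⟨choiceRule a, Or.inr ⟨a, ⟨ha, h⟩, rfl⟩, head_mem_atoms rfl⟩

/-- A body none of whose literals is falsified by `N` holds in the reduct. -/
theorem reductKeeps_and_bpos_subset_iff {r : Rule} {N : Set Lit} {A : Set Atom}
    (hN : consistentS N) (hA : completeOver N A) (hr : r.bodyAtoms ⊆ A) :
    (reductKeeps r (posPart N) ∧ r.bpos ⊆ posPart N) ↔ ¬ ∃ l ∈ r.sBody, l.compl ∈ N := by
  constructor
  · rintro ⟨⟨h1, h2⟩, h3⟩ ⟨l, (⟨b, hb, rfl⟩ | ⟨b, hb, rfl⟩) | ⟨b, hb, rfl⟩, hl⟩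
    · exact hN b ⟨h3 hb, hl⟩
    · exact h1 b hb hl
    · exact hN b ⟨h2 b hb, hl⟩
  · intro h
    push Not at h
    refine ⟨⟨?_, ?_⟩, ?_⟩
    · exact fun b hb => h _ (Or.inl (Or.inr ⟨b, hb, rfl⟩))
    · intro b hb
      exact (hA.1 b (hr (Or.inr hb))).resolve_right (h _ (Or.inr ⟨b, hb, rfl⟩))
    · intro b hb
      exact (hA.1 b (hr (Or.inl (Or.inl hb)))).resolve_right
        (h _ (Or.inl (Or.inl ⟨b, hb, rfl⟩)))

theorem bodyAtoms_subset_atomsTh {F : CNF} {P : Program} {r : Rule} (hr : r ∈ P) :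
    r.bodyAtoms ⊆ atomsTh F P :=
  fun _ ha => atoms_subset_atomsTh hr (Or.inr ha)

theorem compl_mem_ruleClause_of_mem_sBody {r : Rule} {l : Lit} (hl : l ∈ r.sBody) :
    l.compl ∈ ruleClause r := by
  rcases hl with (⟨b, hb, rfl⟩ | ⟨b, hb, rfl⟩) | ⟨b, hb, rfl⟩
  · exact Or.inr (Or.inl (Or.inl ⟨b, hb, rfl⟩))
  · exact Or.inr (Or.inl (Or.inr ⟨b, hb, rfl⟩))
  · exact Or.inr (Or.inr ⟨b, hb, rfl⟩)

theorem exists_mem_ruleClause_iff {r : Rule} {N : Set Lit} :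
    (∃ l ∈ ruleClause r, l ∈ N) ↔
      (∃ a, r.head = some a ∧ Lit.pos a ∈ N) ∨ ∃ l ∈ r.sBody, l.compl ∈ N := by
  constructor
  · rintro ⟨l, h | (⟨b, hb, rfl⟩ | ⟨b, hb, rfl⟩) | ⟨b, hb, rfl⟩, hl⟩
    · left
      cases hr : r.head with
      | none => simp [hr] at h
      | some a =>
        simp only [hr, Set.mem_singleton_iff] at h
        exact ⟨a, rfl, h ▸ hl⟩
    · exact Or.inr ⟨_, Or.inl (Or.inl ⟨b, hb, rfl⟩), hl⟩
    · exact Or.inr ⟨_, Or.inl (Or.inr ⟨b, hb, rfl⟩), hl⟩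
    · exact Or.inr ⟨_, Or.inr ⟨b, hb, rfl⟩, hl⟩
  · rintro (⟨a, ha, hN⟩ | ⟨l, hl, hN⟩)
    · exact ⟨_, pos_mem_ruleClause ha, hN⟩
    · exact ⟨_, compl_mem_ruleClause_of_mem_sBody hl, hN⟩

theorem smModel.entails_progCl {F : CNF} {P : Program} {N : Set Lit} (hN : smModel F P N)
    {C : Clause} (hC : C ∈ progCl P) : ∃ l ∈ C, l ∈ N := by
  obtain ⟨r, hr, rfl⟩ := hC
  rw [exists_mem_ruleClause_iff]
  by_contra! hcon
  obtain ⟨h1, h2⟩ := hcon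
  obtain ⟨hk, hb⟩ := (reductKeeps_and_bpos_subset_iff hN.1 hN.2.1
    (bodyAtoms_subset_atomsTh hr)).2 (by push Not; exact h2)
  cases hh : r.head with
  | none => exact hN.2.2.2.2 r (Or.inl hr) hh hk hb
  | some a => exact h1 a hh (hN.2.2.2.closedUnder_self r (Or.inl hr) hk hb a hh)

/-- Unfounded sets on part of a model contain only atoms that are false in the model. -/
theorem smModel.neg_mem_of_unfoundedOn {F : CNF} {P : Program} {N M : Set Lit}
    (hN : smModel F P N) (hM : M ⊆ N) {U : Set Atom} (hU : unfoundedOn U M (progO F P))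
    {a : Atom} (ha : a ∈ U) : Lit.neg a ∈ N := by
  rw [hN.neg_mem_iff (atomsProg_progO F P ▸ hU.1 ha)]
  intro haN
  have hans : isAnswerSet _ (posPart N) := hN.2.2.2
  have hcl : closedUnder (P ∪ factRule '' (posPart N \ headSet P)) (posPart N)
      (posPart N \ U) := by
    intro r hr hk hb c hc
    refine ⟨hans.closedUnder_self r hr hk (hb.trans Set.sdiff_subset) c hc, fun hcU => ?_⟩
    rcases hr with hr | ⟨d, hd, rfl⟩
    · rcases hU.2 c hcU r (Or.inl hr) hc with ⟨l, hl, hlM⟩ | ⟨b, hbr, hbU⟩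
      · exact (reductKeeps_and_bpos_subset_iff hN.1 hN.2.1 (bodyAtoms_subset_atomsTh hr)).1
          ⟨hk, hb.trans Set.sdiff_subset⟩ ⟨l, hl, hM hlM⟩
      · exact (hb hbr).2 hbU
    · obtain rfl : d = c := by simpa [factRule] using hc
      have hdA : d ∈ atomsTh F P := hN.2.1.2 _ hd.1
      rcases hU.2 d hcU (choiceRule d) (Or.inr ⟨d, ⟨hdA, hd.2⟩, rfl⟩) rfl with
        ⟨l, hl, hlM⟩ | ⟨b, hbr, -⟩
      · have : l = Lit.pos d := by simpa [Rule.sBody, choiceRule] using hl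
        subst this
        exact hN.1 d ⟨hd.1, hM hlM⟩
      · exact hbr
  have : a ∈ ⋂₀ {Y | closedUnder (P ∪ factRule '' (posPart N \ headSet P)) (posPart N) Y} :=
    hans.1 ▸ haN
  exact (this _ hcl).2 ha

/-! ## Reachable states -/

/-- Every non-decision literal of `M` is entailed by its predecessors in `M`, and no decision
literal is the complement of one of its predecessors. -/
def soundRecord (F : CNF) (P : Program) (M : List ALit) : Prop :=
  ∀ Pre x Q, M = Pre ++ x :: Q →
    (x.dec = false → ∀ N, smModel F P N → litSet Pre ⊆ N → x.lit ∈ N) ∧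
    (x.dec = true → x.lit.compl ∉ litsOf Pre)

theorem soundRecord.of_append {F : CNF} {P : Program} {M L : List ALit}
    (h : soundRecord F P (M ++ L)) : soundRecord F P M := by
  rintro Pre x Q rfl
  exact h Pre x (Q ++ L) (by simp)

theorem soundRecord.append_singleton {F : CNF} {P : Program} {M : List ALit} {x : ALit}
    (h : soundRecord F P M)
    (h1 : x.dec = false → ∀ N, smModel F P N → litSet M ⊆ N → x.lit ∈ N)
    (h2 : x.dec = true → x.lit.compl ∉ litsOf M) : soundRecord F P (M ++ [x]) := by
  intro Pre y Q hQ
  rcases List.eq_nil_or_concat Q with rfl | ⟨Q, z, rfl⟩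
  · obtain ⟨rfl, h⟩ := List.append_inj' hQ rfl
    obtain rfl : x = y := by simpa using h
    exact ⟨h1, h2⟩
  · have hQ' : M ++ [x] = (Pre ++ y :: Q) ++ [z] := by simpa using hQ
    exact h Pre y Q (List.append_inj' hQ' rfl).1

theorem soundRecord.litSet_append_subset {F : CNF} {P : Program} {M Q : List ALit}
    (h : soundRecord F P (M ++ Q)) (hQ : noDecision Q) {N : Set Lit} (hN : smModel F P N)
    (hM : litSet M ⊆ N) : litSet (M ++ Q) ⊆ N := by
  induction Q generalizing M with
  | nil => simpa using hM
  | cons x Q ih =>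
    have hx := (h M x Q rfl).1 (hQ x (by simp)) N hN hM
    rw [List.append_cons]
    exact ih (by simpa using h) (fun y hy => hQ y (by simp [hy]))
      (litSet_append_singleton_subset.2 ⟨hM, hx⟩)

theorem mem_of_entailsClause_insert_compls {F : CNF} {P : Program} {M N : Set Lit} {l : Lit}
    (h : entailsClause F P (insert l (compls M))) (hN : smModel F P N) (hM : M ⊆ N) : l ∈ N := by
  obtain ⟨k, rfl | ⟨m, hm, rfl⟩, hk⟩ := h N hN
  · exact hk
  · exact absurd hk (not_compl_mem_of_consistentS hN.1 (hM hm))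

/-- The invariant of the states reachable from the initial state. -/
def soundNode (F : CNF) (P : Program) : ANode → Prop
  | .fail => ¬ ∃ N, smModel F P N
  | .st M _ => soundRecord F P M

theorem soundNode_of_smlEdge {F : CNF} {P : Program} {s s' : ANode} (hs : soundNode F P s)
    (h : smlEdge F P s s') : soundNode F P s' := by
  obtain ⟨hn, -, h | h⟩ := h
  · cases h with
    | unitPropagateLearn M Γ C l hC hl hk =>
      refine soundRecord.append_singleton hs (fun _ N hN hM => ?_) (by simp)
      have hCN : ∃ k ∈ C, k ∈ N := by
        rcases hC with (hC | hC) | hC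
        · exact hN.2.2.1 C hC
        · exact hN.entails_progCl hC
        · exact (hn.2 C hC).2 N hN
      obtain ⟨k, hkC, hkN⟩ := hCN
      by_cases hkl : k = l
      · exact hkl ▸ hkN
      · exact absurd (hM (hk k hkC hkl)) (not_compl_mem_of_consistentS hN.1 hkN)
    | decide M Γ l hl => exact soundRecord.append_singleton hs (by simp) fun _ => hl.2
    | fail M Γ h1 h2 =>
      rintro ⟨N, hN⟩
      have hMN : litSet ([] ++ M) ⊆ N :=
        soundRecord.litSet_append_subset (M := []) hs h2 hN (by simp [litSet, litsOf])
      obtain ⟨a, hp, hq⟩ := h1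
      exact hN.1 a ⟨hMN hp, hMN hq⟩
    | backjump Pre Q l l' Γ h1 h2 =>
      exact (soundRecord.of_append hs).append_singleton
        (fun _ N hN hM => mem_of_entailsClause_insert_compls h2 hN hM) (by simp)
    | unfounded M Γ U a h1 h2 h3 =>
      exact soundRecord.append_singleton hs
        (fun _ N hN hM => hN.neg_mem_of_unfoundedOn hM h2 h3) (by simp)
  · obtain ⟨M, Γ, C, rfl, rfl, -⟩ := h
    exact hs

theorem soundNode_of_reachable {F : CNF} {P : Program} {s : ANode}
    (h : Relation.ReflTransGen (smlEdge F P) (.st [] ∅) s) : soundNode F P s := by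
  induction h with
  | refl => intro Pre x Q h; simp at h
  | tail _ h ih => exact soundNode_of_smlEdge ih h

theorem isANode_of_reachable {F : CNF} {P : Program} {s : ANode}
    (h : Relation.ReflTransGen (smlEdge F P) (.st [] ∅) s) : isANode F P s := by
  induction h with
  | refl => simp [isANode, isRecord, litsOf]
  | tail _ h _ => exact h.2.1

/-! ## Semi-terminal states -/

section SemiTerminal

variable {F : CNF} {P : Program} {M : List ALit} {Γ : CNF}

theorem smlBasicEdge_append_singleton (hn : isANode F P (.st M Γ)) {x : ALit}
    (hx : x.lit ∉ litsOf M) (hA : x.lit.atom ∈ atomsTh F P)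
    (h : SMLBasic F P (.st M Γ) (.st (M ++ [x]) Γ)) :
    smlBasicEdge F P (.st M Γ) (.st (M ++ [x]) Γ) :=
  ⟨hn, ⟨isRecord_append_singleton hn.1 hx hA, hn.2⟩, h⟩

theorem consistentS_of_semiTerminal (hn : isANode F P (.st M Γ)) (hs : soundRecord F P M)
    (ht : ∀ s, ¬ smlBasicEdge F P (.st M Γ) s) : consistentS (litSet M) := by
  rw [consistentS_litSet_iff]
  intro hM
  rcases noDecision_or_last_decision M with h | ⟨Pre, l, Q, rfl, hQ⟩
  · exact ht .fail ⟨hn, trivial, .fail M Γ hM h⟩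
  · have hl : l.atom ∈ atomsTh F P := hn.1.2 l (by simp [litsOf])
    refine ht (.st (Pre ++ [⟨l.compl, false⟩]) Γ) ⟨hn, ⟨isRecord_append_singleton
      hn.1.of_append ((hs Pre _ Q rfl).2 rfl) (by simpa using hl), hn.2⟩,
      .backjump Pre Q l l.compl Γ hM ?_⟩
    intro N hN
    by_contra! hcon
    have hlN : l ∈ N := (hN.mem_or_compl_mem hl).resolve_right
      (hcon _ (Set.mem_insert _ _))
    have hPre : litSet Pre ⊆ N := by
      intro k hk
      exact (hN.mem_or_compl_mem (hn.1.of_append.2 k hk)).resolve_right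
        (hcon _ (Set.mem_insert_of_mem _ ⟨k, hk, rfl⟩))
    have hsub : litSet ((Pre ++ [⟨l, true⟩]) ++ Q) ⊆ N :=
      soundRecord.litSet_append_subset (by simpa using hs) hQ hN
        (litSet_append_singleton_subset.2 ⟨hPre, hlN⟩)
    obtain ⟨a, hp, hq⟩ := hM
    exact hN.1 a ⟨hsub (by simpa [litSet] using hp), hsub (by simpa [litSet] using hq)⟩

theorem completeOver_of_semiTerminal (hn : isANode F P (.st M Γ))
    (ht : ∀ s, ¬ smlBasicEdge F P (.st M Γ) s) : completeOver (litSet M) (atomsTh F P) := by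
  refine ⟨fun a ha => ?_, hn.1.2⟩
  by_contra! hcon
  exact ht _ (smlBasicEdge_append_singleton hn (x := ⟨.pos a, true⟩) hcon.1 ha
    (.decide M Γ (.pos a) hcon))

theorem modelCNF_of_semiTerminal (hF : IsCNF F) (hP : IsProgram P) (hn : isANode F P (.st M Γ))
    (ht : ∀ s, ¬ smlBasicEdge F P (.st M Γ) s) : modelCNF (litSet M) (F ∪ progCl P) := by
  intro C hC
  by_contra! hcon
  have hne : C.Nonempty := by
    rcases hC with hC | ⟨r, hr, rfl⟩
    · exact (hF.2 C hC).2
    · cases hh : r.head with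
      | some a => exact ⟨_, pos_mem_ruleClause hh⟩
      | none =>
        obtain ⟨a, (ha | ha) | ha⟩ := hP.2.2 r hr hh
        · exact ⟨.neg a, Or.inr (Or.inl (Or.inl ⟨a, ha, rfl⟩))⟩
        · exact ⟨.pos a, Or.inr (Or.inl (Or.inr ⟨a, ha, rfl⟩))⟩
        · exact ⟨.neg a, Or.inr (Or.inr ⟨a, ha, rfl⟩)⟩
  obtain ⟨l, hl⟩ := hne
  refine ht _ (smlBasicEdge_append_singleton hn (x := ⟨l, false⟩) (hcon l hl)
    (atom_mem_atomsTh_of_mem hC hl)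
    (.unitPropagateLearn M Γ C l (Or.inl hC) hl fun k hk _ => ?_))
  exact (mem_or_compl_mem_of_completeOver (completeOver_of_semiTerminal hn ht)
    (atom_mem_atomsTh_of_mem hC hk)).resolve_left (hcon k hk)

theorem inputAnswerSet_of_semiTerminal (hn : isANode F P (.st M Γ))
    (hcons : consistentS (litSet M)) (hcomp : completeOver (litSet M) (atomsTh F P))
    (hmod : modelCNF (litSet M) (F ∪ progCl P))
    (ht : ∀ s, ¬ smlBasicEdge F P (.st M Γ) s) : inputAnswerSet P (posPart (litSet M)) := by
  have hrule : ∀ r ∈ P, reductKeeps r (posPart (litSet M)) → r.bpos ⊆ posPart (litSet M) →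
      ∃ a, r.head = some a ∧ a ∈ posPart (litSet M) := by
    intro r hr hk hb
    exact (exists_mem_ruleClause_iff.1 (hmod _ (Or.inr ⟨r, hr, rfl⟩))).resolve_right
      ((reductKeeps_and_bpos_subset_iff hcons hcomp (bodyAtoms_subset_atomsTh hr)).1 ⟨hk, hb⟩)
  refine ⟨Set.Subset.antisymm ?_ (Set.sInter_subset_of_mem ?_), ?_⟩
  · intro a ha Y hY
    by_contra haY
    have hU : unfoundedOn (posPart (litSet M) \ Y) (litSet M) (progO F P) := by
      refine ⟨fun b hb => ?_, ?_⟩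
      · rw [atomsProg_progO]
        exact hcomp.2 _ hb.1
      · rintro b hb r (hr | ⟨c, hc, rfl⟩) hh
        · by_contra! hcon
          obtain ⟨h1, h2⟩ := hcon
          obtain ⟨hk, hp⟩ := (reductKeeps_and_bpos_subset_iff hcons hcomp
            (bodyAtoms_subset_atomsTh hr)).2 (by push Not; exact h1)
          refine hb.2 (hY r (Or.inl hr) hk (fun d hd => ?_) b hh)
          by_contra hdY
          exact h2 d hd ⟨hp hd, hdY⟩
        · obtain rfl : c = b := by simpa [choiceRule] using hh
          refine absurd (hY (factRule c) (Or.inr ⟨c, ⟨hb.1, hc.2⟩, rfl⟩) ?_ ?_ c rfl) hb.2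
          · simp [reductKeeps, factRule]
          · simp [factRule]
    exact ht _ (smlBasicEdge_append_singleton hn (x := ⟨.neg a, false⟩)
      (fun h => hcons a ⟨ha, h⟩) (hcomp.2 (.pos a) ha)
      (.unfounded M Γ _ a hcons hU ⟨ha, haY⟩))
  · rintro r (hr | ⟨c, hc, rfl⟩) hk hb a ha
    · obtain ⟨b, hb, hbM⟩ := hrule r hr hk hb
      obtain rfl : b = a := by simpa [hb] using ha
      exact hbM
    · obtain rfl : c = a := by simpa [factRule] using ha
      exact hc.1
  · rintro r (hr | ⟨c, hc, rfl⟩) hh hk hb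
    · obtain ⟨b, hb, -⟩ := hrule r hr hk hb
      simp [hb] at hh
    · simp [factRule] at hh

theorem smModel_of_semiTerminal (hF : IsCNF F) (hP : IsProgram P) (hn : isANode F P (.st M Γ))
    (hs : soundRecord F P M) (ht : ∀ s, ¬ smlBasicEdge F P (.st M Γ) s) :
    smModel F P (litSet M) := by
  have hcons := consistentS_of_semiTerminal hn hs ht
  have hcomp := completeOver_of_semiTerminal hn ht
  have hmod := modelCNF_of_semiTerminal hF hP hn ht
  exact ⟨hcons, hcomp, fun C hC => hmod C (Or.inl hC),
    inputAnswerSet_of_semiTerminal hn hcons hcomp hmod ht⟩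

end SemiTerminal

theorem smlEdge_of_smlBasicEdge {F : CNF} {P : Program} {s s' : ANode}
    (h : smlBasicEdge F P s s') : smlEdge F P s s' :=
  ⟨h.1, h.2.1, Or.inl h.2.2⟩

/-- From every state a state without outgoing basic edges is reachable. -/
theorem exists_reachable_semiTerminal {F : CNF} {P : Program} {n : ℕ}
    (hn : ∀ M, isRecord (atomsTh F P) M → M.length ≤ n) (s : ANode) :
    ∃ s', Relation.ReflTransGen (smlEdge F P) s s' ∧ ∀ t, ¬ smlBasicEdge F P s' t := by
  by_cases h : ∃ t, smlBasicEdge F P s t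
  · obtain ⟨t, h⟩ := h
    have hlt := nodeWeight_lt_of_smlBasicEdge hn h
    have hle := nodeWeight_le n t
    obtain ⟨s', h1, h2⟩ := exists_reachable_semiTerminal hn t
    exact ⟨s', .head (smlEdge_of_smlBasicEdge h) h1, h2⟩
  · exact ⟨s, .refl, not_exists.1 h⟩
termination_by 3 ^ n - nodeWeight n s

/-- For any SM(ASP) theory `[F,Π]`: (a) every path in `SM(ASP)L_{F,Π}`
contains only finitely many edges justified by basic transition rules; (b) for any
semi-terminal state `M‖Γ` reachable from `∅‖∅`, `M` is a model of `[F,Π]`; (c) `fail` is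
reachable from `∅‖∅` iff `[F,Π]` has no models. -/
theorem smaspl_graph_properties (F : CNF) (P : Program) (hF : IsCNF F) (hP : IsProgram P) :
    (∀ p : ℕ → ANode, (∀ n : ℕ, smlEdge F P (p n) (p (n + 1))) →
      {n : ℕ | smlBasicEdge F P (p n) (p (n + 1))}.Finite) ∧
    (∀ (M : List ALit) (Γ : CNF),
      Relation.ReflTransGen (smlEdge F P) (.st [] ∅) (.st M Γ) →
      (∀ n' : ANode, ¬ smlBasicEdge F P (.st M Γ) n') → smModel F P (litSet M)) ∧
    (Relation.ReflTransGen (smlEdge F P) (.st [] ∅) .fail ↔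
      ¬ ∃ M : Set Lit, smModel F P M) := by
  obtain ⟨n, hn⟩ : ∃ n, ∀ M, isRecord (atomsTh F P) M → M.length ≤ n :=
    ⟨_, fun _ hM => hM.length_le (atomsTh_finite hF hP)⟩
  refine ⟨fun p hp => ?_, fun M Γ hr ht => ?_, fun h => soundNode_of_reachable h, fun h => ?_⟩
  · have hmono : Monotone fun k => nodeWeight n (p k) := by
      refine monotone_nat_of_le_succ fun k => ?_
      obtain ⟨h1, h2, h | h⟩ := hp k
      · exact (nodeWeight_lt_of_smlBasicEdge hn ⟨h1, h2, h⟩).le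
      · exact (nodeWeight_eq_of_learnStep n h).le
    exact (finite_setOf_lt_succ_of_monotone_of_le hmono fun k => nodeWeight_le n (p k)).subset
      fun k hk => nodeWeight_lt_of_smlBasicEdge hn hk
  · exact smModel_of_semiTerminal hF hP (isANode_of_reachable hr) (soundNode_of_reachable hr) ht
  · obtain ⟨s, hr, ht⟩ := exists_reachable_semiTerminal hn (.st [] ∅)
    cases s with
    | fail => exact hr
    | st M Γ =>
      exact absurd ⟨_, smModel_of_semiTerminal hF hP (isANode_of_reachable hr)
        (soundNode_of_reachable hr) ht⟩ h
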